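/- Let 0 ≤ β < d and 1 < p ≤ q < ∞ with β/d = 1/p − 1/q, and let Φ be a Young function with Φ̄ ∈ B_{p,q}. Let V be an n×n matrix weight on ℝ^d, let 𝒟 be a dyadic grid, and for each Q ∈ 𝒟 let 𝒱_Q^Φ be a reducing operator of V^{−1/p} with respect to Φ. Then the auxiliary maximal operator M^𝒟_{β,V} f(x) = sup_{Q∈𝒟, Q∋x} |Q|^{β/d} ( |Q|^{−1}∫_Q |(𝒱_Q^Φ)^{−1} V(y)^{−1/p} f(y)| dy ) is bounded from L^p(ℝ^d,ℂ^n) to L^q(ℝ^d). -/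

import Mathlib

open MeasureTheory ENNReal
open scoped NNReal ComplexOrder

noncomputable section

abbrev Rd (d : ℕ) := EuclideanSpace ℝ (Fin d)
abbrev Cn (n : ℕ) := EuclideanSpace ℂ (Fin n)
abbrev Mat (n : ℕ) := Matrix (Fin n) (Fin n) ℂ

/-- An axis-parallel (half-open) cube in `ℝ^d`. -/
structure Cube (d : ℕ) where
  corner : Fin d → ℝ
  side : ℝ
  side_pos : 0 < side

namespace Cube

/-- The set of points of a cube. -/
def set {d : ℕ} (Q : Cube d) : Set (Rd d) :=
  {x | ∀ i, Q.corner i ≤ x i ∧ x i < Q.corner i + Q.side}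

/-- The volume `|Q|` of a cube. -/
def vol {d : ℕ} (Q : Cube d) : ℝ := Q.side ^ d

end Cube

/-- A matrix acting on `ℂ^n` (with the Euclidean norm). -/
def mulVecE {n : ℕ} (A : Mat n) (v : Cn n) : Cn n :=
  Matrix.toEuclideanLin A v

/-- The operator norm `|A|_op` of a matrix acting on `ℓ²(ℂ^n)`. -/
def opNorm {n : ℕ} (A : Mat n) : ℝ :=
  ‖Matrix.toEuclideanCLM (𝕜 := ℂ) A‖

/-- Real powers of a self-adjoint matrix, defined via diagonalization. -/
def matPow {n : ℕ} (A : Mat n) (r : ℝ) : Mat n :=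
  if hA : A.IsHermitian then
    (hA.eigenvectorUnitary : Mat n) *
      Matrix.diagonal (fun i => ((hA.eigenvalues i ^ r : ℝ) : ℂ)) *
      (star hA.eigenvectorUnitary : Mat n)
  else A

/-- A matrix weight: self-adjoint matrix valued, locally integrable entries,
positive definite a.e. -/
def IsMatrixWeight {d n : ℕ} (U : Rd d → Mat n) : Prop :=
  (∀ i j, MeasureTheory.LocallyIntegrable (fun x => U x i j) volume) ∧
    (∀ᵐ x, (U x).PosDef)

/-- A Young function: convex, increasing, `Φ(0) = 0` and `Φ(t)/t → ∞`. -/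
structure IsYoungFunction (Φ : ℝ → ℝ) : Prop where
  convexOn : ConvexOn ℝ (Set.Ici 0) Φ
  monotoneOn : MonotoneOn Φ (Set.Ici 0)
  map_zero : Φ 0 = 0
  tendsto : Filter.Tendsto (fun t => Φ t / t) Filter.atTop Filter.atTop

/-- The associate Young function `Φ̄(t) = sup_{s>0} (st - Φ(s))`. -/
def assoc (Φ : ℝ → ℝ) : ℝ → ℝ :=
  fun t => sSup ((fun s => s * t - Φ s) '' Set.Ioi (0 : ℝ))

/-- The `B_{p,q}` condition: `∫_1^∞ Φ(t)^{q/p} t^{-q} dt/t < ∞`. -/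
def MemBpq (Φ : ℝ → ℝ) (p q : ℝ) : Prop :=
  ∫⁻ t in Set.Ioi (1 : ℝ), ENNReal.ofReal (Φ t ^ (q / p) / t ^ (q + 1)) < ⊤

/-- The `B_p` condition: `∫_1^∞ Φ(t) t^{-p} dt/t < ∞`. -/
def MemBp (Φ : ℝ → ℝ) (p : ℝ) : Prop :=
  ∫⁻ t in Set.Ioi (1 : ℝ), ENNReal.ofReal (Φ t / t ^ (p + 1)) < ⊤

/-- Localized Luxemburg (Orlicz) norm over a cube, for `ℝ≥0∞`-valued functions. -/
def luxNormE {d : ℕ} (Φ : ℝ → ℝ) (Q : Cube d) (f : Rd d → ℝ≥0∞) : ℝ≥0∞ :=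
  sInf {lam : ℝ≥0∞ | 0 < lam ∧ lam < ⊤ ∧
    (∫⁻ x in Q.set, ENNReal.ofReal (Φ ((f x).toReal / lam.toReal))) ≤ ENNReal.ofReal Q.vol}

/-- Localized Luxemburg (Orlicz) norm over a cube of a real valued function. -/
def luxNorm {d : ℕ} (Φ : ℝ → ℝ) (Q : Cube d) (f : Rd d → ℝ) : ℝ≥0∞ :=
  luxNormE Φ Q fun x => ENNReal.ofReal |f x|

/-- The (unweighted) `L^p` norm of a vector valued function. -/
def lpNorm {d n : ℕ} (p : ℝ) (f : Rd d → Cn n) : ℝ≥0∞ :=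
  (∫⁻ x, (‖f x‖₊ : ℝ≥0∞) ^ p) ^ (1 / p)

/-- The matrix-weighted `L^p(W)` norm `(∫ |W^{1/p} f|^p)^{1/p}`. -/
def wLpNorm {d n : ℕ} (p : ℝ) (W : Rd d → Mat n) (f : Rd d → Cn n) : ℝ≥0∞ :=
  (∫⁻ x, (‖mulVecE (matPow (W x) (1 / p)) (f x)‖₊ : ℝ≥0∞) ^ p) ^ (1 / p)


/-- A dyadic grid: side lengths are powers of two, cubes are nested or disjoint,
and the cubes of a fixed side length `2^k` partition `ℝ^d`. -/
def IsDyadicGrid {d : ℕ} (𝒟 : Set (Cube d)) : Prop :=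
  (∀ Q ∈ 𝒟, ∃ k : ℤ, Q.side = (2 : ℝ) ^ k) ∧
  (∀ Q ∈ 𝒟, ∀ R ∈ 𝒟, Q.set ⊆ R.set ∨ R.set ⊆ Q.set ∨ Disjoint Q.set R.set) ∧
  (∀ (k : ℤ) (x : Rd d), ∃! Q : Cube d, Q ∈ 𝒟 ∧ Q.side = (2 : ℝ) ^ k ∧ x ∈ Q.set)

/-- `M` is a reducing operator of the matrix function `A` with respect to the Young function `Φ`
on the cube `Q`, with comparability constants `c₁, c₂`:  `|M e| ≈ ‖A e‖_{Φ,Q}` for all `e`. -/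
def ReducesOrlicz {d n : ℕ} (c₁ c₂ : ℝ) (Φ : ℝ → ℝ) (A : Rd d → Mat n) (Q : Cube d)
    (M : Mat n) : Prop :=
  M.PosDef ∧ ∀ e : Cn n,
    ENNReal.ofReal c₁ * luxNorm Φ Q (fun x => ‖mulVecE (A x) e‖) ≤ (‖mulVecE M e‖₊ : ℝ≥0∞) ∧
    (‖mulVecE M e‖₊ : ℝ≥0∞) ≤ ENNReal.ofReal c₂ * luxNorm Φ Q (fun x => ‖mulVecE (A x) e‖)

/-- The auxiliary dyadic fractional maximal operator `M^𝒟_{β,V}` built from the reducing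
operators `𝒱 Q` of `V^{-1/p}`. -/
def auxDyadicMax {d n : ℕ} (β p : ℝ) (𝒟 : Set (Cube d)) (𝒱 : Cube d → Mat n)
    (V : Rd d → Mat n) (f : Rd d → Cn n) (x : Rd d) : ℝ≥0∞ :=
  ⨆ (Q : Cube d) (_ : Q ∈ 𝒟) (_ : x ∈ Q.set),
    ENNReal.ofReal (Q.vol ^ (β / (d : ℝ) - 1)) *
      ∫⁻ y in Q.set, (‖mulVecE (𝒱 Q)⁻¹ (mulVecE (matPow (V y) (-(1 / p))) (f y))‖₊ : ℝ≥0∞)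

theorem matPow_eq_cfc {n : ℕ} {A : Mat n} (hA : A.IsHermitian) (r : ℝ) :
    matPow A r = cfc (fun x : ℝ => x ^ r) A := by
  rw [hA.cfc_eq, matPow, dif_pos hA, Matrix.IsHermitian.cfc, Unitary.conjStarAlgAut_apply]
  rfl

theorem matPow_isHermitian {n : ℕ} {A : Mat n} (hA : A.IsHermitian) (r : ℝ) :
    (matPow A r).IsHermitian := by
  rw [matPow_eq_cfc hA]
  exact (cfc_predicate (fun x : ℝ => x ^ r) A : IsSelfAdjoint _)

/-- A sequence of polynomials converging to `x ^ r` at every positive `x`. -/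
theorem exists_polynomial_tendsto_rpow (r : ℝ) :
    ∃ P : ℕ → Polynomial ℝ, ∀ x : ℝ, 0 < x →
      Filter.Tendsto (fun m => (P m).eval x) Filter.atTop (nhds (x ^ r)) := by
  have h : ∀ m : ℕ, ∃ P : Polynomial ℝ, ∀ x ∈ Set.Icc ((1 : ℝ) / (m + 1)) (m + 1),
      |P.eval x - x ^ r| < 1 / (m + 1) := by
    intro m
    refine exists_polynomial_near_of_continuousOn _ _ _ ?_ _ (by positivity)
    intro x hx
    have : 0 < x := lt_of_lt_of_le (by positivity) hx.1
    exact (Real.continuousAt_rpow_const x r (Or.inl this.ne')).continuousWithinAt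
  choose P hP using h
  refine ⟨P, fun x hx => ?_⟩
  rw [tendsto_iff_dist_tendsto_zero]
  refine squeeze_zero' (Filter.Eventually.of_forall fun _ => dist_nonneg) ?_
    tendsto_one_div_add_atTop_nhds_zero_nat
  have h1 := (tendsto_one_div_add_atTop_nhds_zero_nat (𝕜 := ℝ)).eventually (ge_mem_nhds hx)
  have h2 := tendsto_natCast_atTop_atTop (R := ℝ) |>.eventually_ge_atTop x
  filter_upwards [h1, h2] with m hm1 hm2
  exact (hP m x ⟨hm1, by linarith⟩).le

theorem tendsto_aeval_matPow {n : ℕ} {A : Mat n} (hA : A.PosDef) {r : ℝ} {P : ℕ → Polynomial ℝ}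
    (hP : ∀ x : ℝ, 0 < x → Filter.Tendsto (fun m => (P m).eval x) Filter.atTop (nhds (x ^ r))) :
    Filter.Tendsto (fun m => Polynomial.aeval A (P m)) Filter.atTop (nhds (matPow A r)) := by
  have hsa : IsSelfAdjoint A := hA.isHermitian
  have h : ∀ f : ℝ → ℝ, cfc f A = (hA.isHermitian.eigenvectorUnitary : Mat n) *
      Matrix.diagonal (fun i => ((f (hA.isHermitian.eigenvalues i) : ℝ) : ℂ)) *
      (star hA.isHermitian.eigenvectorUnitary : Mat n) := by
    intro f
    rw [hA.isHermitian.cfc_eq, Matrix.IsHermitian.cfc, Unitary.conjStarAlgAut_apply]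
    rfl
  rw [matPow_eq_cfc hA.isHermitian, h]
  simp_rw [← cfc_polynomial (R := ℝ) (p := IsSelfAdjoint) _ A, h]
  refine Filter.Tendsto.mul_const _ (Filter.Tendsto.const_mul _ ?_)
  refine (Continuous.tendsto (Continuous.matrix_diagonal continuous_id) _).comp ?_
  rw [tendsto_pi_nhds]
  intro i
  exact (Complex.continuous_ofReal.tendsto _).comp (hP _ (hA.eigenvalues_pos i))

theorem aemeasurable_matPow {d n : ℕ} {V : Rd d → Mat n} (hV : IsMatrixWeight V) (r : ℝ) :
    ∀ i j, AEMeasurable (fun x => matPow (V x) r i j) volume := by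
  obtain ⟨P, hP⟩ := exists_polynomial_tendsto_rpow r
  intro i j
  refine aemeasurable_of_tendsto_metrizable_ae Filter.atTop
    (f := fun m x => Polynomial.aeval (V x) (P m) i j) (fun m => ?_) ?_
  · have hpow : ∀ k : ℕ, ∀ i j, AEMeasurable (fun x => (V x ^ k) i j) volume := by
      intro k
      induction k with
      | zero => intro i j; simp only [pow_zero]; exact aemeasurable_const
      | succ k ih =>
        intro i j
        simp only [pow_succ, Matrix.mul_apply]
        exact Finset.aemeasurable_fun_sum _ fun l _ =>
          (ih i l).mul (hV.1 l j).aestronglyMeasurable.aemeasurable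
    simp only [Polynomial.aeval_eq_sum_range, Matrix.sum_apply, Matrix.smul_apply,
      Complex.real_smul]
    exact Finset.aemeasurable_fun_sum _ fun l _ => (hpow l i j).const_mul _
  · filter_upwards [hV.2] with x hx
    exact ((continuous_apply_apply i j).tendsto _).comp (tendsto_aeval_matPow hx hP)

theorem aemeasurable_norm_mulVecE {d n : ℕ} {B : Rd d → Mat n}
    (hB : ∀ i j, AEMeasurable (fun x => B x i j) volume) (e : Cn n) :
    AEMeasurable (fun x => ‖mulVecE (B x) e‖) volume := by
  simp only [mulVecE, EuclideanSpace.norm_eq, Matrix.toLpLin_apply, Matrix.mulVec, dotProduct]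
  refine (Finset.aemeasurable_fun_sum _ fun i _ => ?_).sqrt
  exact ((Finset.aemeasurable_fun_sum _ fun j _ => (hB i j).mul_const _).norm).pow_const _

theorem inner_mulVecE_of_isHermitian {n : ℕ} {A : Mat n} (hA : A.IsHermitian) (u v : Cn n) :
    inner ℂ u (mulVecE A v) = inner ℂ (mulVecE A u) v := by
  have := Matrix.isSymmetric_toEuclideanLin_iff.2 hA
  exact (this u v).symm

theorem norm_mulVecE_mulVecE_le {n : ℕ} {A B : Mat n} (hA : A.IsHermitian) (hB : B.IsHermitian)
    (v : Cn n) : ‖mulVecE A (mulVecE B v)‖ ≤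
      (∑ j, ‖mulVecE B (mulVecE A (EuclideanSpace.single j 1))‖) * ‖v‖ := by
  have h : ∀ w : Cn n, ‖w‖ ≤ ∑ j, ‖inner ℂ (EuclideanSpace.single j (1 : ℂ)) w‖ := by
    intro w
    conv_lhs => rw [← (EuclideanSpace.basisFun (Fin n) ℂ).sum_repr' w]
    refine (norm_sum_le _ _).trans (Finset.sum_le_sum fun j _ => ?_)
    rw [norm_smul]
    simp
  refine (h _).trans ?_
  rw [Finset.sum_mul]
  refine Finset.sum_le_sum fun j _ => ?_
  rw [inner_mulVecE_of_isHermitian hA, inner_mulVecE_of_isHermitian hB]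
  exact norm_inner_le_norm _ _

namespace Cube

theorem set_eq_preimage {d : ℕ} (Q : Cube d) :
    Q.set = (fun x : Rd d => x.ofLp) ⁻¹'
      Set.univ.pi fun i => Set.Ico (Q.corner i) (Q.corner i + Q.side) := by
  ext x
  simp [set]

theorem measurableSet_set {d : ℕ} (Q : Cube d) : MeasurableSet Q.set := by
  rw [set_eq_preimage]
  exact (MeasurableSet.univ_pi fun _ => measurableSet_Ico).preimage (by fun_prop)

theorem vol_pos {d : ℕ} (Q : Cube d) : 0 < Q.vol := pow_pos Q.side_pos d

theorem volume_set {d : ℕ} (Q : Cube d) : volume Q.set = ENNReal.ofReal Q.vol := by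
  rw [set_eq_preimage]
  refine ((PiLp.volume_preserving_ofLp (Fin d)).measure_preimage
    (MeasurableSet.univ_pi fun _ => measurableSet_Ico).nullMeasurableSet).trans ?_
  rw [Real.volume_pi_Ico]
  simp [vol, ENNReal.ofReal_pow Q.side_pos.le]

theorem interior_set_nonempty {d : ℕ} (Q : Cube d) : (interior Q.set).Nonempty := by
  have hs := Q.side_pos
  refine ⟨WithLp.toLp 2 fun i => Q.corner i + Q.side / 2, ?_⟩
  have ho : IsOpen ((fun x : Rd d => x.ofLp) ⁻¹'
      Set.univ.pi fun i => Set.Ioo (Q.corner i) (Q.corner i + Q.side)) :=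
    (isOpen_set_pi Set.finite_univ fun _ _ => isOpen_Ioo).preimage (by fun_prop)
  refine interior_maximal ?_ ho ?_
  · rw [set_eq_preimage]
    exact Set.preimage_mono (Set.pi_mono fun _ _ => Set.Ioo_subset_Ico_self)
  · intro i _
    constructor <;> simp <;> linarith

theorem vol_le_of_set_subset {d : ℕ} {Q R : Cube d} (h : Q.set ⊆ R.set) : Q.vol ≤ R.vol := by
  have := measure_mono (μ := volume) h
  rwa [volume_set, volume_set, ENNReal.ofReal_le_ofReal_iff R.vol_pos.le] at this

theorem side_le_of_set_subset {d : ℕ} (hd : d ≠ 0) {Q R : Cube d} (h : Q.set ⊆ R.set) :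
    Q.side ≤ R.side :=
  (pow_le_pow_iff_left₀ Q.side_pos.le R.side_pos.le hd).1 (vol_le_of_set_subset h)

end Cube

namespace IsDyadicGrid

variable {d : ℕ} {𝒟 : Set (Cube d)}

theorem eq_of_side_eq (h𝒟 : IsDyadicGrid 𝒟) {Q R : Cube d} (hQ : Q ∈ 𝒟) (hR : R ∈ 𝒟)
    (hs : Q.side = R.side) {x : Rd d} (hxQ : x ∈ Q.set) (hxR : x ∈ R.set) : Q = R := by
  obtain ⟨k, hk⟩ := h𝒟.1 R hR
  exact (h𝒟.2.2 k x).unique ⟨hQ, hs.trans hk, hxQ⟩ ⟨hR, hk, hxR⟩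

theorem countable (h𝒟 : IsDyadicGrid 𝒟) : 𝒟.Countable := by
  have h : 𝒟 ⊆ ⋃ k : ℤ, {Q | Q ∈ 𝒟 ∧ Q.side = (2 : ℝ) ^ k} := by
    intro Q hQ
    obtain ⟨k, hk⟩ := h𝒟.1 Q hQ
    exact Set.mem_iUnion.2 ⟨k, hQ, hk⟩
  refine (Set.countable_iUnion fun k => ?_).mono h
  refine Set.PairwiseDisjoint.countable_of_nonempty_interior (s := Cube.set) ?_
    fun Q _ => Q.interior_set_nonempty
  intro Q hQ R hR hne
  refine Set.disjoint_left.2 fun x hxQ hxR => hne ?_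
  exact h𝒟.eq_of_side_eq hQ.1 hR.1 (hQ.2.trans hR.2.symm) hxQ hxR

end IsDyadicGrid

/-- The part of `Ψ` above `1`, with values in `ℝ≥0∞`. -/
def youngTail (Ψ : ℝ → ℝ) (t : ℝ) : ℝ≥0∞ :=
  if 1 < t then ENNReal.ofReal (Ψ t) else 0

/-- The integrand of the `B_{p,q}` condition with respect to `dt/t`, cut off below `1`. -/
def bumpTail (Ψ : ℝ → ℝ) (p q t : ℝ) : ℝ≥0∞ :=
  if 1 < t then ENNReal.ofReal (Ψ t ^ (q / p) / t ^ q) else 0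

theorem measurable_youngTail {Ψ : ℝ → ℝ} (hΨ : Monotone Ψ) : Measurable (youngTail Ψ) :=
  Measurable.ite measurableSet_Ioi hΨ.measurable.ennreal_ofReal measurable_const

theorem measurable_bumpTail {Ψ : ℝ → ℝ} (hΨ : Monotone Ψ) (p q : ℝ) :
    Measurable (bumpTail Ψ p q) :=
  Measurable.ite measurableSet_Ioi
    ((hΨ.measurable.pow_const _).div (measurable_id.pow_const _)).ennreal_ofReal measurable_const

theorem bumpTail_le_lintegral {Ψ : ℝ → ℝ} (hΨ : Monotone Ψ) (hΨ0 : ∀ t, 0 ≤ Ψ t) {p q t : ℝ}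
    (hp : 0 < p) (hq : 0 < q) (ht : 1 < t) :
    bumpTail Ψ p q t ≤ ENNReal.ofReal (2 ^ (q + 1)) *
      ∫⁻ s in Set.Ico t (2 * t), ENNReal.ofReal (Ψ s ^ (q / p) / s ^ (q + 1)) := by
  have ht0 : 0 < t := by linarith
  have h1 : ∫⁻ _ in Set.Ico t (2 * t), ENNReal.ofReal (Ψ t ^ (q / p) / (2 * t) ^ (q + 1)) ≤
      ∫⁻ s in Set.Ico t (2 * t), ENNReal.ofReal (Ψ s ^ (q / p) / s ^ (q + 1)) := by
    refine setLIntegral_mono' measurableSet_Ico fun s hs => ENNReal.ofReal_le_ofReal ?_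
    have hs0 : 0 < s := ht0.trans_le hs.1
    refine div_le_div₀ (Real.rpow_nonneg (hΨ0 s) _)
      (Real.rpow_le_rpow (hΨ0 t) (hΨ hs.1) (by positivity)) (Real.rpow_pos_of_pos hs0 _)
      (Real.rpow_le_rpow hs0.le hs.2.le (by positivity))
  refine le_trans ?_ (mul_le_mul_right h1 _)
  rw [setLIntegral_const, Real.volume_Ico, ← ENNReal.ofReal_mul' (by linarith),
    ← ENNReal.ofReal_mul (by positivity), bumpTail, if_pos ht]
  refine ENNReal.ofReal_le_ofReal (le_of_eq ?_)
  rw [Real.mul_rpow (by norm_num) ht0.le, Real.rpow_add_one ht0.ne']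
  have h2 : (0 : ℝ) < 2 ^ (q + 1) := by positivity
  have h3 : 0 < t ^ q := by positivity
  field_simp
  ring

/-- The sum of `bumpTail` along a lacunary family is controlled by the `B_{p,q}` integral. -/
theorem tsum_bumpTail_le {ι : Type*} [Countable ι] {Ψ : ℝ → ℝ} (hΨ : Monotone Ψ)
    (hΨ0 : ∀ t, 0 ≤ Ψ t) {p q : ℝ} (hp : 0 < p) (hq : 0 < q) (S : Set ι) (t : ι → ℝ)
    (hsep : ∀ i ∈ S, ∀ j ∈ S, i ≠ j → 2 * t i ≤ t j ∨ 2 * t j ≤ t i) :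
    ∑' i, S.indicator (fun i => bumpTail Ψ p q (t i)) i ≤ ENNReal.ofReal (2 ^ (q + 1)) *
      ∫⁻ s in Set.Ioi (1 : ℝ), ENNReal.ofReal (Ψ s ^ (q / p) / s ^ (q + 1)) := by
  classical
  set w : ℝ → ℝ≥0∞ := fun s => ENNReal.ofReal (Ψ s ^ (q / p) / s ^ (q + 1))
  set ν : Measure ℝ := (volume.restrict (Set.Ioi (1 : ℝ))).withDensity w
  let I : ι → Set ℝ := fun i => if i ∈ S ∧ 1 < t i then Set.Ico (t i) (2 * t i) else ∅
  have hIm : ∀ i, MeasurableSet (I i) := fun i => by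
    by_cases h : i ∈ S ∧ 1 < t i
    · simp only [I, if_pos h]; exact measurableSet_Ico
    · simp only [I, if_neg h]; exact MeasurableSet.empty
  have hterm : ∀ i, S.indicator (fun i => bumpTail Ψ p q (t i)) i ≤
      ENNReal.ofReal (2 ^ (q + 1)) * ν (I i) := by
    intro i
    by_cases h : i ∈ S ∧ 1 < t i
    · rw [Set.indicator_of_mem h.1]
      refine (bumpTail_le_lintegral hΨ hΨ0 hp hq h.2).trans (le_of_eq ?_)
      congr 1
      rw [withDensity_apply _ (hIm i), Measure.restrict_restrict (hIm i)]
      simp only [I, if_pos h]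
      congr 2
      refine (Set.inter_eq_left.2 fun s hs => ?_).symm
      exact h.2.trans_le hs.1
    · by_cases hi : i ∈ S
      · have : ¬ 1 < t i := fun h' => h ⟨hi, h'⟩
        simp [Set.indicator_of_mem hi, bumpTail, this]
      · simp [hi]
  refine (ENNReal.tsum_le_tsum hterm).trans ?_
  rw [ENNReal.tsum_mul_left]
  refine mul_le_mul_right ?_ _
  refine (tsum_measure_le_measure_univ (fun i => (hIm i).nullMeasurableSet) ?_).trans ?_
  · intro i j hij
    refine Disjoint.aedisjoint (Set.disjoint_left.2 fun s hsi hsj => ?_)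
    simp only [I] at hsi hsj
    split_ifs at hsi hsj with h1 h2
    · rcases hsep i h1.1 j h2.1 hij with h | h
      · exact absurd (hsi.2.trans_le h) (not_lt.2 hsj.1)
      · exact absurd (hsj.2.trans_le h) (not_lt.2 hsi.1)
    · exact hsj
    · exact hsi
    · exact hsi
  · rw [withDensity_apply _ MeasurableSet.univ, Measure.restrict_univ]

theorem rpow_lintegral_youngTail_le {α : Type*} [MeasurableSpace α] {ν : Measure α} {Ψ : ℝ → ℝ}
    (hΨ : Monotone Ψ) (hΨ0 : ∀ t, 0 ≤ Ψ t) {p q μ : ℝ} (hp : 0 < p) (hpq : p ≤ q) (hμ : 0 < μ)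
    {φ : α → ℝ} (hφ : Measurable φ) :
    (ENNReal.ofReal (μ ^ p) * ∫⁻ y, youngTail Ψ (φ y / μ) ∂ν) ^ (q / p) ≤
      (∫⁻ y, ENNReal.ofReal (φ y ^ p) ∂ν) ^ (q / p - 1) *
        ∫⁻ y, ENNReal.ofReal (φ y ^ p) * bumpTail Ψ p q (φ y / μ) ∂ν := by
  have hq : 0 < q := hp.trans_le hpq
  have hφp : Measurable fun y => ENNReal.ofReal (φ y ^ p) := (hφ.pow_const _).ennreal_ofReal
  have hpt : ∀ y, ENNReal.ofReal (μ ^ p) * youngTail Ψ (φ y / μ) =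
      ENNReal.ofReal (φ y ^ p) ^ (1 - p / q) *
        (ENNReal.ofReal (φ y ^ p) * bumpTail Ψ p q (φ y / μ)) ^ (p / q) := by
    intro y
    by_cases h : 1 < φ y / μ
    · have hy : 0 < φ y := by
        have := (lt_div_iff₀ hμ).1 h
        linarith
      have hΨy := hΨ0 (φ y / μ)
      simp only [youngTail, bumpTail, if_pos h]
      rw [← ENNReal.ofReal_mul (by positivity), ← ENNReal.ofReal_mul (by positivity),
        ENNReal.ofReal_rpow_of_pos (by positivity),
        ENNReal.ofReal_rpow_of_nonneg (by positivity) (by positivity),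
        ← ENNReal.ofReal_mul (by positivity)]
      congr 1
      rw [Real.mul_rpow (by positivity) (by positivity), ← mul_assoc,
        ← Real.rpow_add (by positivity), sub_add_cancel, Real.rpow_one,
        Real.div_rpow (by positivity) (by positivity), ← Real.rpow_mul hΨy,
        ← Real.rpow_mul (by positivity), div_mul_div_cancel₀ hp.ne', div_self hq.ne',
        Real.rpow_one, mul_div_cancel₀ _ hq.ne', Real.div_rpow hy.le hμ.le]
      have h1 : 0 < φ y ^ p := by positivity
      have h2 : 0 < μ ^ p := by positivity
      field_simp
    · simp only [youngTail, bumpTail, if_neg h, mul_zero]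
      rw [ENNReal.zero_rpow_of_pos (by positivity), mul_zero]
  have hle : p / q ≤ 1 := (div_le_one hq).2 hpq
  have := ENNReal.lintegral_mul_norm_pow_le (μ := ν) hφp.aemeasurable
    (hφp.mul ((measurable_bumpTail hΨ p q).comp (hφ.div_const μ))).aemeasurable
    (p := 1 - p / q) (q := p / q) (by linarith) (by positivity) (by ring)
  have hm : Measurable fun y => youngTail Ψ (φ y / μ) :=
    (measurable_youngTail hΨ).comp (hφ.div_const μ)
  rw [← lintegral_const_mul _ hm]
  simp only [Pi.mul_apply, Function.comp_apply] at this
  simp_rw [hpt]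
  refine (ENNReal.rpow_le_rpow this (by positivity)).trans (le_of_eq ?_)
  rw [ENNReal.mul_rpow_of_nonneg _ _ (by positivity), ← ENNReal.rpow_mul, ← ENNReal.rpow_mul,
    div_mul_div_cancel₀ hq.ne', div_self hp.ne', ENNReal.rpow_one, sub_mul,
    div_mul_div_cancel₀ hq.ne', div_self hp.ne', one_mul]

theorem le_two_mul_of_forall_zpow {M T : ℝ≥0∞}
    (h : ∀ k : ℤ, ENNReal.ofReal ((2 : ℝ) ^ k) < M → ENNReal.ofReal ((2 : ℝ) ^ k) ≤ T) :
    M ≤ 2 * T := by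
  have h2 : ∀ k : ℤ, ENNReal.ofReal ((2 : ℝ) ^ k) = (2 : ℝ≥0∞) ^ k := fun k => by
    rw [← Real.rpow_intCast, ← ENNReal.ofReal_rpow_of_pos (by norm_num), ENNReal.rpow_intCast]
    simp
  simp only [h2] at h
  by_contra! hlt
  rcases eq_or_ne T 0 with rfl | hT
  · rw [mul_zero] at hlt
    rcases eq_or_ne M ⊤ with rfl | hM
    · have := h 0 (by simp)
      simp at this
    · obtain ⟨k, hk, -⟩ := ENNReal.exists_mem_Ioc_zpow hlt.ne' hM (y := 2) (by norm_num) (by simp)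
      have := h k hk
      have h3 : (2 : ℝ≥0∞) ^ k ≠ 0 := (ENNReal.zpow_pos (by simp) (by simp) k).ne'
      exact h3 (le_zero_iff.1 this)
  · have hT' : T ≠ ⊤ := by
      rintro rfl
      simp at hlt
    obtain ⟨k, hk, hk'⟩ := ENNReal.exists_mem_Ico_zpow hT hT' (y := 2) (by norm_num) (by simp)
    have h3 : (2 : ℝ≥0∞) ^ (k + 1) ≤ 2 * T := by
      rw [ENNReal.zpow_add (by simp) (by simp), zpow_one, mul_comm]
      gcongr
    exact absurd (h _ (h3.trans_lt hlt)) (not_le.2 hk')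

/-- `(k, Q)` such that `Q` is maximal in the finite family `F` among the cubes with `g Q > 2 ^ k`. -/
def maximalPairs {d : ℕ} (F : Finset (Cube d)) (g : Cube d → ℝ≥0∞) : Set (ℤ × F) :=
  {i | ENNReal.ofReal ((2 : ℝ) ^ i.1) < g i.2 ∧
    ∀ R ∈ F, ENNReal.ofReal ((2 : ℝ) ^ i.1) < g R → (i.2 : Cube d).set ⊆ R.set → R = i.2}

section maximalPairs

variable {d : ℕ} {𝒟 : Set (Cube d)} {F : Finset (Cube d)} {g : Cube d → ℝ≥0∞}

theorem exists_mem_maximalPairs (hd : d ≠ 0) (h𝒟 : IsDyadicGrid 𝒟) (hF : ∀ Q ∈ F, Q ∈ 𝒟)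
    {x : Rd d} {k : ℤ} {Q : Cube d} (hQ : Q ∈ F) (hx : x ∈ Q.set)
    (hg : ENNReal.ofReal ((2 : ℝ) ^ k) < g Q) :
    ∃ R : F, (k, R) ∈ maximalPairs F g ∧ x ∈ (R : Cube d).set := by
  classical
  obtain ⟨R, hR, hmax⟩ := Finset.exists_max_image
    (F.filter fun R => x ∈ R.set ∧ ENNReal.ofReal ((2 : ℝ) ^ k) < g R) Cube.side
    ⟨Q, by simp [hQ, hx, hg]⟩
  simp only [Finset.mem_filter] at hR hmax
  refine ⟨⟨R, hR.1⟩, ⟨hR.2.2, fun T hT hgT hsub => ?_⟩, hR.2.1⟩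
  have h1 := hmax T ⟨hT, hsub hR.2.1, hgT⟩
  have h2 := Cube.side_le_of_set_subset hd hsub
  exact h𝒟.eq_of_side_eq (hF T hT) (hF R hR.1) (le_antisymm h1 h2) (hsub hR.2.1) hR.2.1

theorem subset_of_mem_maximalPairs (h𝒟 : IsDyadicGrid 𝒟) (hF : ∀ Q ∈ F, Q ∈ 𝒟)
    {x : Rd d} {i j : ℤ × F} (hi : i ∈ maximalPairs F g) (hj : j ∈ maximalPairs F g)
    (hxi : x ∈ (i.2 : Cube d).set) (hxj : x ∈ (j.2 : Cube d).set) (hij : i.1 ≤ j.1) :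
    (j.2 : Cube d).set ⊆ (i.2 : Cube d).set := by
  have hk : ENNReal.ofReal ((2 : ℝ) ^ i.1) ≤ ENNReal.ofReal ((2 : ℝ) ^ j.1) :=
    ENNReal.ofReal_le_ofReal (zpow_le_zpow_right₀ (by norm_num) hij)
  rcases h𝒟.2.1 _ (hF _ i.2.2) _ (hF _ j.2.2) with h | h | h
  · rw [hi.2 _ j.2.2 (hk.trans_lt hj.1) h]
  · exact h
  · exact absurd hxj (Set.disjoint_left.1 h hxi)

theorem maximalPairs_lacunary (h𝒟 : IsDyadicGrid 𝒟) (hF : ∀ Q ∈ F, Q ∈ 𝒟) {b : ℝ} (hb : 0 ≤ b)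
    {x : Rd d} {i j : ℤ × F} (hi : i ∈ maximalPairs F g) (hj : j ∈ maximalPairs F g)
    (hxi : x ∈ (i.2 : Cube d).set) (hxj : x ∈ (j.2 : Cube d).set) (hij : i.1 < j.1) :
    2 * ((2 : ℝ) ^ i.1 * (i.2 : Cube d).vol ^ (-b)) ≤
      (2 : ℝ) ^ j.1 * (j.2 : Cube d).vol ^ (-b) := by
  have hv := Cube.vol_le_of_set_subset (subset_of_mem_maximalPairs h𝒟 hF hi hj hxi hxj hij.le)
  have h1 : (i.2 : Cube d).vol ^ (-b) ≤ (j.2 : Cube d).vol ^ (-b) :=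
    Real.rpow_le_rpow_of_nonpos (Cube.vol_pos _) hv (by linarith)
  have h2 : 2 * (2 : ℝ) ^ i.1 ≤ (2 : ℝ) ^ j.1 := by
    rw [mul_comm, ← zpow_add_one₀ (by norm_num)]
    exact zpow_le_zpow_right₀ (by norm_num) hij
  rw [← mul_assoc]
  exact mul_le_mul h2 h1 (Real.rpow_nonneg (Cube.vol_pos _).le _) (by positivity)

theorem eq_of_mem_maximalPairs (h𝒟 : IsDyadicGrid 𝒟) (hF : ∀ Q ∈ F, Q ∈ 𝒟)
    {x : Rd d} {i j : ℤ × F} (hi : i ∈ maximalPairs F g) (hj : j ∈ maximalPairs F g)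
    (hxi : x ∈ (i.2 : Cube d).set) (hxj : x ∈ (j.2 : Cube d).set) (hij : i.1 = j.1) : i = j := by
  have h1 := subset_of_mem_maximalPairs h𝒟 hF hi hj hxi hxj hij.le
  refine Prod.ext hij (Subtype.ext ?_)
  exact hj.2 _ i.2.2 (hij ▸ hi.1) h1

theorem iSup_indicator_rpow_le_tsum (hd : d ≠ 0) (h𝒟 : IsDyadicGrid 𝒟) (hF : ∀ Q ∈ F, Q ∈ 𝒟)
    {q : ℝ} (hq : 0 < q) (x : Rd d) :
    (⨆ Q ∈ F, Q.set.indicator (fun _ => g Q) x) ^ q ≤ 2 ^ q *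
      ∑' i : ℤ × F, (maximalPairs F g).indicator
        (fun i => (i.2 : Cube d).set.indicator (fun _ => ENNReal.ofReal ((2 : ℝ) ^ i.1) ^ q) x) i := by
  set S := ∑' i : ℤ × F, (maximalPairs F g).indicator
        (fun i => (i.2 : Cube d).set.indicator (fun _ => ENNReal.ofReal ((2 : ℝ) ^ i.1) ^ q) x) i
    with hS
  have key : (⨆ Q ∈ F, Q.set.indicator (fun _ => g Q) x) ≤ 2 * S ^ (1 / q) := by
    refine le_two_mul_of_forall_zpow fun k hk => ?_
    simp only [lt_iSup_iff] at hk
    obtain ⟨Q, hQ, hk⟩ := hk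
    have hx : x ∈ Q.set := by
      by_contra hx
      simp [hx] at hk
    rw [Set.indicator_of_mem hx] at hk
    obtain ⟨R, hR, hxR⟩ := exists_mem_maximalPairs hd h𝒟 hF hQ hx hk
    rw [one_div, ENNReal.le_rpow_inv_iff hq]
    refine le_trans (le_of_eq ?_) (ENNReal.le_tsum (k, R))
    rw [Set.indicator_of_mem hR, Set.indicator_of_mem hxR]
  refine (ENNReal.rpow_le_rpow key hq.le).trans (le_of_eq ?_)
  rw [ENNReal.mul_rpow_of_nonneg _ _ hq.le, ← ENNReal.rpow_mul, one_div_mul_cancel hq.ne',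
    ENNReal.rpow_one]

end maximalPairs

theorem lintegral_iSup_finset_rpow_le {d : ℕ} (hd : d ≠ 0) {𝒟 : Set (Cube d)}
    (h𝒟 : IsDyadicGrid 𝒟) {F : Finset (Cube d)} (hF : ∀ Q ∈ F, Q ∈ 𝒟) {Ψ : ℝ → ℝ}
    (hΨ : Monotone Ψ) (hΨ0 : ∀ t, 0 ≤ Ψ t) {b p q : ℝ} (hp : 0 < p) (hpq : p ≤ q)
    (hb : 0 ≤ b) (hexp : b = 1 / p - 1 / q) {φ : Rd d → ℝ} (hφ : Measurable φ)
    (hφ0 : ∀ x, 0 ≤ φ x) {g : Cube d → ℝ≥0∞}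
    (hg : ∀ Q ∈ 𝒟, ∀ l : ℝ, 0 < l → ENNReal.ofReal l < g Q →
      ENNReal.ofReal Q.vol ≤ ∫⁻ y in Q.set, youngTail Ψ (φ y / (l * Q.vol ^ (-b)))) :
    ∫⁻ x, (⨆ Q ∈ F, Q.set.indicator (fun _ => g Q) x) ^ q ≤
      2 ^ q * (ENNReal.ofReal (2 ^ (q + 1)) *
        ∫⁻ s in Set.Ioi (1 : ℝ), ENNReal.ofReal (Ψ s ^ (q / p) / s ^ (q + 1))) *
        (∫⁻ y, ENNReal.ofReal (φ y ^ p)) ^ (q / p) := by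
  have hq : 0 < q := hp.trans_le hpq
  have hr : 1 ≤ q / p := (one_le_div hp).2 hpq
  set B : ℝ≥0∞ := ENNReal.ofReal (2 ^ (q + 1)) *
        ∫⁻ s in Set.Ioi (1 : ℝ), ENNReal.ofReal (Ψ s ^ (q / p) / s ^ (q + 1)) with hB
  set J : ℝ≥0∞ := ∫⁻ y, ENNReal.ofReal (φ y ^ p) with hJ
  let μ : ℤ × F → ℝ := fun i => (2 : ℝ) ^ i.1 * (i.2 : Cube d).vol ^ (-b)
  have hμ : ∀ i, 0 < μ i := fun i =>
    mul_pos (by positivity) (Real.rpow_pos_of_pos (Cube.vol_pos _) _)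
  have hφp : Measurable fun y => ENNReal.ofReal (φ y ^ p) := (hφ.pow_const _).ennreal_ofReal
  let H : ℤ × F → Rd d → ℝ≥0∞ := fun i => (i.2 : Cube d).set.indicator
    fun y => ENNReal.ofReal (φ y ^ p) * bumpTail Ψ p q (φ y / μ i)
  have hHm : ∀ i, Measurable (H i) := fun i =>
    (hφp.mul ((measurable_bumpTail hΨ p q).comp (hφ.div_const _))).indicator
      (Cube.measurableSet_set _)
  have hterm : ∀ i ∈ maximalPairs F g, ENNReal.ofReal ((2 : ℝ) ^ i.1) ^ q *
      ENNReal.ofReal (i.2 : Cube d).vol ≤ J ^ (q / p - 1) * ∫⁻ y, H i y := by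
    intro i hi
    have hv := Cube.vol_pos (i.2 : Cube d)
    have h1 := hg _ (hF _ i.2.2) _ (by positivity) hi.1
    have h2 := rpow_lintegral_youngTail_le (ν := volume.restrict (i.2 : Cube d).set) hΨ hΨ0 hp hpq
      (hμ i) hφ
    have h3 : ENNReal.ofReal ((2 : ℝ) ^ i.1) ^ q * ENNReal.ofReal (i.2 : Cube d).vol =
        (ENNReal.ofReal (μ i ^ p) * ENNReal.ofReal (i.2 : Cube d).vol) ^ (q / p) := by
      have hm := hμ i
      rw [← ENNReal.ofReal_mul (by positivity), ENNReal.ofReal_rpow_of_pos (by positivity),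
        ENNReal.ofReal_rpow_of_pos (by positivity), ← ENNReal.ofReal_mul (by positivity)]
      congr 1
      rw [Real.mul_rpow (by positivity) hv.le, ← Real.rpow_mul hm.le, mul_div_cancel₀ _ hp.ne',
        Real.mul_rpow (by positivity) (by positivity), ← Real.rpow_mul hv.le, mul_assoc,
        ← Real.rpow_add hv]
      have : -b * q + q / p = 1 := by
        rw [hexp]; field_simp; ring
      rw [this, Real.rpow_one]
    rw [h3]
    refine (ENNReal.rpow_le_rpow (mul_le_mul_right h1 _) (by positivity)).trans (h2.trans ?_)
    refine mul_le_mul' (ENNReal.rpow_le_rpow (lintegral_mono' Measure.restrict_le_self le_rfl)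
      (by linarith)) (le_of_eq ?_)
    exact (lintegral_indicator (Cube.measurableSet_set _) _).symm
  calc ∫⁻ x, (⨆ Q ∈ F, Q.set.indicator (fun _ => g Q) x) ^ q
      ≤ ∫⁻ x, 2 ^ q * ∑' i : ℤ × F, (maximalPairs F g).indicator (fun i =>
          (i.2 : Cube d).set.indicator (fun _ => ENNReal.ofReal ((2 : ℝ) ^ i.1) ^ q) x) i :=
        lintegral_mono fun x => iSup_indicator_rpow_le_tsum hd h𝒟 hF hq x
    _ = 2 ^ q * ∑' i : ℤ × F, (maximalPairs F g).indicator (fun i =>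
          ENNReal.ofReal ((2 : ℝ) ^ i.1) ^ q * ENNReal.ofReal (i.2 : Cube d).vol) i := by
        have hm : ∀ i : ℤ × F, Measurable fun x => (maximalPairs F g).indicator (fun i =>
            (i.2 : Cube d).set.indicator (fun _ => ENNReal.ofReal ((2 : ℝ) ^ i.1) ^ q) x) i := by
          intro i
          by_cases hi : i ∈ maximalPairs F g
          · simp only [Set.indicator_of_mem hi]
            exact measurable_const.indicator (Cube.measurableSet_set _)
          · simp only [Set.indicator_of_notMem hi]
            exact measurable_const
        rw [lintegral_const_mul _ (Measurable.tsum hm),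
          lintegral_tsum fun i => (hm i).aemeasurable]
        congr 2
        ext i
        by_cases hi : i ∈ maximalPairs F g
        · simp only [Set.indicator_of_mem hi]
          rw [lintegral_indicator_const (Cube.measurableSet_set _), Cube.volume_set]
        · simp [hi]
    _ ≤ 2 ^ q * ∑' i : ℤ × F, J ^ (q / p - 1) *
          ∫⁻ y, (maximalPairs F g).indicator (fun i => H i y) i := by
        refine mul_le_mul_right (ENNReal.tsum_le_tsum fun i => ?_) _
        by_cases hi : i ∈ maximalPairs F g
        · simp only [Set.indicator_of_mem hi]
          exact hterm i hi
        · simp [hi]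
    _ = 2 ^ q * (J ^ (q / p - 1) *
          ∫⁻ y, ∑' i : ℤ × F, (maximalPairs F g).indicator (fun i => H i y) i) := by
        rw [ENNReal.tsum_mul_left, lintegral_tsum]
        intro i
        by_cases hi : i ∈ maximalPairs F g
        · simp only [Set.indicator_of_mem hi]
          exact (hHm i).aemeasurable
        · simp only [Set.indicator_of_notMem hi]
          exact aemeasurable_const
    _ ≤ 2 ^ q * (J ^ (q / p - 1) * ∫⁻ y, B * ENNReal.ofReal (φ y ^ p)) := by
        refine mul_le_mul_right (mul_le_mul_right (lintegral_mono fun y => ?_) _) _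
        have h1 : ∀ i, (maximalPairs F g).indicator (fun i => H i y) i =
            ENNReal.ofReal (φ y ^ p) *
              {i : ℤ × F | i ∈ maximalPairs F g ∧ y ∈ (i.2 : Cube d).set}.indicator
                (fun i => bumpTail Ψ p q (φ y / μ i)) i := by
          intro i
          by_cases hi : i ∈ maximalPairs F g <;> by_cases hy : y ∈ (i.2 : Cube d).set <;>
            simp [H, hi, hy]
        simp_rw [h1]
        rw [ENNReal.tsum_mul_left, mul_comm]
        refine mul_le_mul_left (tsum_bumpTail_le hΨ hΨ0 hp hq _ _ ?_) _
        have hlac : ∀ i j : ℤ × F, 2 * μ i ≤ μ j → 2 * (φ y / μ j) ≤ φ y / μ i := by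
          intro i j hij
          rw [← mul_div_assoc, div_le_div_iff₀ (hμ j) (hμ i)]
          nlinarith [hφ0 y]
        rintro i ⟨hi, hyi⟩ j ⟨hj, hyj⟩ hne
        rcases lt_trichotomy i.1 j.1 with h | h | h
        · exact Or.inr (hlac i j (maximalPairs_lacunary h𝒟 hF hb hi hj hyi hyj h))
        · exact absurd (eq_of_mem_maximalPairs h𝒟 hF hi hj hyi hyj h) hne
        · exact Or.inl (hlac j i (maximalPairs_lacunary h𝒟 hF hb hj hi hyj hyi h))
    _ = 2 ^ q * B * J ^ (q / p) := by
        rw [lintegral_const_mul _ hφp, ← hJ]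
        have : J ^ (q / p) = J ^ (q / p - 1) * J := by
          simpa using ENNReal.rpow_add_of_nonneg (x := J) (q / p - 1) 1 (by linarith) zero_le_one
        rw [this]
        ring

namespace IsYoungFunction

variable {Φ : ℝ → ℝ}

theorem nonneg (hΦ : IsYoungFunction Φ) {s : ℝ} (hs : 0 ≤ s) : 0 ≤ Φ s := by
  rw [← hΦ.map_zero]
  exact hΦ.monotoneOn Set.self_mem_Ici hs hs

theorem bddAbove_assoc (hΦ : IsYoungFunction Φ) (t : ℝ) :
    BddAbove ((fun s => s * t - Φ s) '' Set.Ioi (0 : ℝ)) := by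
  obtain ⟨T, hT⟩ := Filter.eventually_atTop.1 (hΦ.tendsto.eventually_ge_atTop t)
  refine ⟨|T| * |t|, ?_⟩
  rintro _ ⟨s, hs, rfl⟩
  have hs : 0 < s := hs
  have h0 : 0 ≤ |T| * |t| := by positivity
  rcases le_total T s with h | h
  · have h1 := (le_div_iff₀ hs).1 (hT s h)
    simp only
    linarith
  · have h1 : s * t ≤ |T| * |t| :=
      (mul_le_mul_of_nonneg_left (le_abs_self t) hs.le).trans
        (mul_le_mul_of_nonneg_right (h.trans (le_abs_self T)) (abs_nonneg t))
    have h2 := hΦ.nonneg hs.le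
    simp only
    linarith

theorem le_assoc (hΦ : IsYoungFunction Φ) {s : ℝ} (hs : 0 < s) (t : ℝ) :
    s * t - Φ s ≤ assoc Φ t :=
  le_csSup (hΦ.bddAbove_assoc t) ⟨s, hs, rfl⟩

theorem monotone_assoc (hΦ : IsYoungFunction Φ) : Monotone (assoc Φ) := by
  intro t u htu
  refine csSup_le (Set.nonempty_Ioi.image _) ?_
  rintro _ ⟨s, hs, rfl⟩
  refine le_trans ?_ (hΦ.le_assoc hs u)
  have := mul_le_mul_of_nonneg_left htu (le_of_lt hs)
  simp only
  linarith

theorem assoc_nonneg (hΦ : IsYoungFunction Φ) (t : ℝ) : 0 ≤ assoc Φ t := by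
  have h : ∀ m : ℕ, (1 / ((m : ℝ) + 1)) * (t - Φ 1) ≤ assoc Φ t := by
    intro m
    have hm : (0 : ℝ) < 1 / ((m : ℝ) + 1) := by positivity
    have hm1 : 1 / ((m : ℝ) + 1) ≤ 1 := by
      rw [div_le_one (by positivity)]
      linarith [(Nat.cast_nonneg m : (0 : ℝ) ≤ m)]
    refine le_trans ?_ (hΦ.le_assoc hm t)
    have hc := hΦ.convexOn.2 (x := 0) (y := 1) Set.self_mem_Ici (by simp)
      (sub_nonneg.2 hm1) hm.le (by ring)
    simp only [smul_eq_mul, mul_zero, mul_one, zero_add, hΦ.map_zero] at hc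
    rw [mul_sub]
    linarith
  have hlim := (tendsto_one_div_add_atTop_nhds_zero_nat (𝕜 := ℝ)).mul_const (t - Φ 1)
  rw [zero_mul] at hlim
  exact le_of_tendsto' hlim h

theorem mul_le_add_assoc (hΦ : IsYoungFunction Φ) {s : ℝ} (hs : 0 ≤ s) (t : ℝ) :
    s * t ≤ Φ s + assoc Φ t := by
  rcases hs.eq_or_lt with rfl | hs
  · simpa [hΦ.map_zero] using hΦ.assoc_nonneg t
  · linarith [hΦ.le_assoc hs t]

end IsYoungFunction

theorem lintegral_le_vol_of_luxNorm_lt {d : ℕ} {Φ : ℝ → ℝ} (hΦ : IsYoungFunction Φ) {Q : Cube d}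
    {w : Rd d → ℝ} (hw : ∀ x, 0 ≤ w x) {K : ℝ} (h : luxNorm Φ Q w < ENNReal.ofReal K) :
    ∫⁻ x in Q.set, ENNReal.ofReal (Φ (w x / K)) ≤ ENNReal.ofReal Q.vol := by
  obtain ⟨l, ⟨hl0, hltop, hl⟩, hlK⟩ := sInf_lt_iff.1 h
  refine le_trans (lintegral_mono fun x => ENNReal.ofReal_le_ofReal ?_) hl
  have hl' : 0 < l.toReal := ENNReal.toReal_pos hl0.ne' hltop.ne
  have hlK' : l.toReal ≤ K := by
    refine le_of_lt ?_
    rwa [← ENNReal.lt_ofReal_iff_toReal_lt hltop.ne]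
  have hK : 0 < K := hl'.trans_le hlK'
  rw [ENNReal.toReal_ofReal (abs_nonneg _), abs_of_nonneg (hw x)]
  exact hΦ.monotoneOn (div_nonneg (hw x) hK.le) (div_nonneg (hw x) hl'.le)
    (div_le_div_of_nonneg_left (hw x) hl' hlK')

theorem ofReal_mul_le_young {Φ : ℝ → ℝ} (hΦ : IsYoungFunction Φ) {w φ K η : ℝ} (hw : 0 ≤ w)
    (hK : 0 < K) (hη : 0 < η) :
    ENNReal.ofReal (w * φ) ≤ ENNReal.ofReal (K * η) *
      (ENNReal.ofReal (Φ (w / K)) +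
        (ENNReal.ofReal (assoc Φ 1) + youngTail (assoc Φ) (φ / η))) := by
  have hwK : 0 ≤ w / K := by positivity
  have h0 := hΦ.nonneg hwK
  have h1 := hΦ.assoc_nonneg 1
  have heq : w * φ = K * η * ((w / K) * (φ / η)) := by field_simp
  rw [heq, ENNReal.ofReal_mul (by positivity)]
  refine mul_le_mul_right ?_ _
  by_cases h : 1 < φ / η
  · rw [youngTail, if_pos h, ← ENNReal.ofReal_add h1 (hΦ.assoc_nonneg _),
      ← ENNReal.ofReal_add h0 (by linarith [hΦ.assoc_nonneg (φ / η)])]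
    refine ENNReal.ofReal_le_ofReal ?_
    linarith [hΦ.mul_le_add_assoc hwK (φ / η)]
  · rw [youngTail, if_neg h, add_zero, ← ENNReal.ofReal_add h0 h1]
    refine ENNReal.ofReal_le_ofReal ?_
    have h2 : w / K * (φ / η) ≤ w / K * 1 := mul_le_mul_of_nonneg_left (not_lt.1 h) hwK
    linarith [hΦ.mul_le_add_assoc hwK 1]

/-- If a fractional average of `(∑ j, w j) φ` exceeds `l`, with the `w j` normalised in the Orlicz
space of `Φ`, then the associate function of `φ` has large integral at the matching scale. -/
theorem vol_le_lintegral_youngTail {d n : ℕ} {Φ : ℝ → ℝ} (hΦ : IsYoungFunction Φ) {Q : Cube d}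
    {w : Fin n → Rd d → ℝ} (hw : ∀ j, AEMeasurable (w j) volume) (hw0 : ∀ j x, 0 ≤ w j x)
    {K : ℝ} (hK : 0 < K)
    (hlux : ∀ j, ∫⁻ x in Q.set, ENNReal.ofReal (Φ (w j x / K)) ≤ ENNReal.ofReal Q.vol)
    {φ : Rd d → ℝ} (hφ : Measurable φ) (hφ0 : ∀ x, 0 ≤ φ x) {θ b l : ℝ} (hθ : 0 < θ)
    (hθK : n * (K * θ * (2 + assoc Φ 1)) ≤ 1) (hl : 0 < l)
    (h : ENNReal.ofReal l < ENNReal.ofReal (Q.vol ^ (b - 1)) *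
      ∫⁻ x in Q.set, ENNReal.ofReal (∑ j, w j x) * ENNReal.ofReal (φ x)) :
    ENNReal.ofReal Q.vol ≤
      ∫⁻ x in Q.set, youngTail (assoc Φ) (φ x / θ / (l * Q.vol ^ (-b))) := by
  by_contra! hlt
  refine absurd h (not_lt.2 ?_)
  have hv := Q.vol_pos
  set μ := l * Q.vol ^ (-b) with hμdef
  have hμ : 0 < μ := by positivity
  have hΨ1 := hΦ.assoc_nonneg 1
  have hGm : Measurable fun x => youngTail (assoc Φ) (φ x / (θ * μ)) :=
    (measurable_youngTail hΦ.monotone_assoc).comp (hφ.div_const _)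
  have hGm' : Measurable fun x =>
      ENNReal.ofReal (assoc Φ 1) + youngTail (assoc Φ) (φ x / (θ * μ)) := measurable_const.add hGm
  simp_rw [div_div] at hlt
  have hj : ∀ j, ∫⁻ x in Q.set, ENNReal.ofReal (w j x * φ x) ≤
      ENNReal.ofReal (K * (θ * μ) * ((2 + assoc Φ 1) * Q.vol)) := by
    intro j
    refine (lintegral_mono fun x => ofReal_mul_le_young hΦ (hw0 j x) hK
      (mul_pos hθ hμ)).trans ?_
    rw [lintegral_const_mul' _ _ ENNReal.ofReal_ne_top,
      lintegral_add_right _ hGm', lintegral_add_right _ hGm,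
      setLIntegral_const, Q.volume_set]
    refine (mul_le_mul_right (add_le_add (hlux j) (add_le_add le_rfl hlt.le)) _).trans
      (le_of_eq ?_)
    rw [← ENNReal.ofReal_mul hΨ1, ← ENNReal.ofReal_add (by positivity) hv.le,
      ← ENNReal.ofReal_add hv.le (by positivity), ← ENNReal.ofReal_mul (by positivity)]
    congr 1
    ring
  have hsum : ∫⁻ x in Q.set, ENNReal.ofReal (∑ j, w j x) * ENNReal.ofReal (φ x) ≤
      ENNReal.ofReal (μ * Q.vol) := by
    have h1 : ∀ x, ENNReal.ofReal (∑ j, w j x) * ENNReal.ofReal (φ x) =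
        ∑ j, ENNReal.ofReal (w j x * φ x) := by
      intro x
      rw [← ENNReal.ofReal_mul (Finset.sum_nonneg fun j _ => hw0 j x), Finset.sum_mul,
        ENNReal.ofReal_sum_of_nonneg fun j _ => mul_nonneg (hw0 j x) (hφ0 x)]
    simp_rw [h1]
    have h2 : ∀ j, AEMeasurable (fun x => ENNReal.ofReal (w j x * φ x))
        (volume.restrict Q.set) := fun j =>
      ((hw j).mul hφ.aemeasurable).restrict.ennreal_ofReal
    rw [lintegral_finsetSum' _ fun j _ => h2 j]
    refine (Finset.sum_le_sum fun j _ => hj j).trans ?_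
    rw [Finset.sum_const, Finset.card_univ, Fintype.card_fin, ← ENNReal.ofReal_nsmul]
    refine ENNReal.ofReal_le_ofReal ?_
    rw [nsmul_eq_mul]
    have := mul_le_mul_of_nonneg_right hθK (mul_pos hμ hv).le
    linarith
  refine (mul_le_mul_right hsum _).trans (le_of_eq ?_)
  rw [← ENNReal.ofReal_mul (by positivity), hμdef]
  congr 1
  rw [mul_assoc, mul_left_comm, ← Real.rpow_add_one hv.ne', ← Real.rpow_add hv]
  simp

/-- A measurable minorant with the same (lower) `L^p` norm can replace the original function in
integrals against measurable weights. -/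
theorem lintegral_mul_le_of_minorant {α : Type*} [MeasurableSpace α] {ν : Measure α} {p : ℝ}
    (hp : 0 < p) {f φ : α → ℝ≥0∞} (hφ : Measurable φ) (hφf : φ ≤ f)
    (hfin : ∫⁻ x, φ x ^ p ∂ν ≠ ⊤) (hint : ∫⁻ x, f x ^ p ∂ν = ∫⁻ x, φ x ^ p ∂ν)
    {w : α → ℝ} (hw : AEMeasurable w ν) (S : Set α) :
    ∫⁻ x in S, ENNReal.ofReal (w x) * f x ∂ν ≤ ∫⁻ x in S, ENNReal.ofReal (w x) * φ x ∂ν := by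
  have hww : ∀ᵐ x ∂ν.restrict S, w x = hw.mk w x := ae_restrict_of_ae hw.ae_eq_mk
  set W : α → ℝ≥0∞ := fun x => ENNReal.ofReal (hw.mk w x) with hW
  have hWm : Measurable W := hw.measurable_mk.ennreal_ofReal
  have e1 : ∀ g : α → ℝ≥0∞, ∫⁻ x in S, ENNReal.ofReal (w x) * g x ∂ν = ∫⁻ x in S, W x * g x ∂ν :=
    fun g => lintegral_congr_ae <| by filter_upwards [hww] with x hx; rw [hx]
  rw [e1, e1]
  obtain ⟨h, hm, hle, heq⟩ := exists_measurable_le_lintegral_eq (ν.restrict S) fun x => W x * f x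
  rw [heq]
  have hdiv : ∀ x, h x / W x ≤ f x := fun x =>
    ENNReal.div_le_of_le_mul (by rw [mul_comm]; exact hle x)
  have hmax : Measurable fun x => max (φ x) (h x / W x) := hφ.max (hm.div hWm)
  have hae : (fun x => φ x ^ p) =ᵐ[ν] fun x => max (φ x) (h x / W x) ^ p := by
    refine ae_eq_of_ae_le_of_lintegral_le (Filter.Eventually.of_forall fun x => ?_) hfin
      (hmax.pow_const p).aemeasurable ?_
    · exact ENNReal.rpow_le_rpow (le_max_left _ _) hp.le
    · rw [← hint]
      exact lintegral_mono fun x => ENNReal.rpow_le_rpow (max_le (hφf x) (hdiv x)) hp.le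
  refine lintegral_mono_ae ?_
  filter_upwards [ae_restrict_of_ae hae] with x hx
  have hx' : φ x = max (φ x) (h x / W x) := ENNReal.rpow_left_injective hp.ne' hx
  have h2 : h x / W x ≤ φ x := by rw [hx']; exact le_max_right _ _
  rcases eq_or_ne (W x) 0 with h0 | h0
  · have : h x ≤ W x * f x := hle x
    rw [h0, zero_mul] at this
    exact this.trans zero_le
  · rw [mul_comm]
    exact (ENNReal.div_le_iff h0 ENNReal.ofReal_ne_top).1 h2

theorem lintegral_iSup_grid_rpow_le {d : ℕ} (hd : d ≠ 0) {𝒟 : Set (Cube d)}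
    (h𝒟 : IsDyadicGrid 𝒟) {Ψ : ℝ → ℝ} (hΨ : Monotone Ψ) (hΨ0 : ∀ t, 0 ≤ Ψ t) {b p q : ℝ}
    (hp : 0 < p) (hpq : p ≤ q) (hb : 0 ≤ b) (hexp : b = 1 / p - 1 / q) {φ : Rd d → ℝ}
    (hφ : Measurable φ) (hφ0 : ∀ x, 0 ≤ φ x) {g : Cube d → ℝ≥0∞}
    (hg : ∀ Q ∈ 𝒟, ∀ l : ℝ, 0 < l → ENNReal.ofReal l < g Q →
      ENNReal.ofReal Q.vol ≤ ∫⁻ y in Q.set, youngTail Ψ (φ y / (l * Q.vol ^ (-b)))) :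
    ∫⁻ x, (⨆ Q ∈ 𝒟, Q.set.indicator (fun _ => g Q) x) ^ q ≤
      2 ^ q * (ENNReal.ofReal (2 ^ (q + 1)) *
        ∫⁻ s in Set.Ioi (1 : ℝ), ENNReal.ofReal (Ψ s ^ (q / p) / s ^ (q + 1))) *
        (∫⁻ y, ENNReal.ofReal (φ y ^ p)) ^ (q / p) := by
  classical
  have hq : 0 < q := hp.trans_le hpq
  have : Countable 𝒟 := h𝒟.countable.to_subtype
  have hpt : ∀ x, (⨆ Q ∈ 𝒟, Q.set.indicator (fun _ => g Q) x) ^ q =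
      ⨆ t : Finset 𝒟, (⨆ Q ∈ t.image Subtype.val, Q.set.indicator (fun _ => g Q) x) ^ q := by
    intro x
    rw [← iSup_subtype'' 𝒟 fun Q => Q.set.indicator (fun _ => g Q) x, iSup_eq_iSup_finset]
    simp_rw [Finset.iSup_finset_image]
    exact (ENNReal.orderIsoRpow q hq).map_iSup _
  simp_rw [hpt]
  rw [lintegral_iSup_directed_of_measurable]
  · refine iSup_le fun t => lintegral_iSup_finset_rpow_le hd h𝒟 ?_ hΨ hΨ0 hp hpq hb hexp hφ hφ0 hg
    intro Q hQ
    obtain ⟨R, -, rfl⟩ := Finset.mem_image.1 hQ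
    exact R.2
  · intro t
    refine Measurable.pow_const ?_ q
    exact Measurable.biSup _ (Finset.countable_toSet _) fun Q _ =>
      measurable_const.indicator Q.measurableSet_set
  · refine Monotone.directed_le fun s t hst x => ENNReal.rpow_le_rpow ?_ hq.le
    exact biSup_mono fun Q hQ => Finset.image_subset_image hst hQ

theorem norm_mulVecE_inv_single {n : ℕ} {M : Mat n} (hM : M.PosDef) (j : Fin n) :
    ‖mulVecE M (mulVecE M⁻¹ (EuclideanSpace.single j 1))‖ = 1 := by
  have h : mulVecE M (mulVecE M⁻¹ (EuclideanSpace.single j (1 : ℂ))) =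
      EuclideanSpace.single j 1 := by
    simp only [mulVecE, Matrix.toLpLin_apply, Matrix.mulVec_mulVec,
      Matrix.mul_nonsing_inv _ ((Matrix.isUnit_iff_isUnit_det _).1 hM.isUnit), Matrix.one_mulVec]
  rw [h]
  simp

theorem auxDyadicMax_eq {d n : ℕ} (β p : ℝ) (𝒟 : Set (Cube d)) (𝒱 : Cube d → Mat n)
    (V : Rd d → Mat n) (f : Rd d → Cn n) (x : Rd d) :
    auxDyadicMax β p 𝒟 𝒱 V f x = ⨆ Q ∈ 𝒟, Q.set.indicator (fun _ =>
      ENNReal.ofReal (Q.vol ^ (β / (d : ℝ) - 1)) *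
        ∫⁻ y in Q.set, (‖mulVecE (𝒱 Q)⁻¹ (mulVecE (matPow (V y) (-(1 / p))) (f y))‖₊ : ℝ≥0∞)) x := by
  unfold auxDyadicMax
  refine iSup_congr fun Q => iSup_congr fun _ => ?_
  by_cases hx : x ∈ Q.set <;> simp [hx]

theorem exists_measurable_minorant {α : Type*} [MeasurableSpace α] (ν : Measure α) {p : ℝ}
    (hp : 0 < p) (f : α → ℝ≥0) :
    ∃ φ : α → ℝ, Measurable φ ∧ (∀ x, 0 ≤ φ x) ∧ (∀ x, ENNReal.ofReal (φ x) ≤ f x) ∧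
      ∫⁻ x, (f x : ℝ≥0∞) ^ p ∂ν = ∫⁻ x, ENNReal.ofReal (φ x) ^ p ∂ν := by
  obtain ⟨h, hm, hle, heq⟩ := exists_measurable_le_lintegral_eq ν fun x => (f x : ℝ≥0∞) ^ p
  have hle' : ∀ x, h x ^ (1 / p) ≤ f x := fun x => by
    rw [one_div, ENNReal.rpow_inv_le_iff hp]
    exact hle x
  have hof : ∀ x, ENNReal.ofReal (h x ^ (1 / p)).toReal = h x ^ (1 / p) := fun x =>
    ENNReal.ofReal_toReal (ne_top_of_le_ne_top ENNReal.coe_ne_top (hle' x))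
  refine ⟨fun x => (h x ^ (1 / p)).toReal, (hm.pow_const _).ennreal_toReal,
    fun x => ENNReal.toReal_nonneg, fun x => (hof x).trans_le (hle' x), ?_⟩
  rw [heq]
  refine lintegral_congr fun x => ?_
  rw [hof, ← ENNReal.rpow_mul, one_div_mul_cancel hp.ne', ENNReal.rpow_one]

theorem lintegral_norm_le_of_minorant {d n : ℕ} {V : Rd d → Mat n} (hV : IsMatrixWeight V)
    {M : Mat n} (hM : M.IsHermitian) {p : ℝ} (hp : 0 < p) (r : ℝ) {f : Rd d → Cn n}
    {φ : Rd d → ℝ} (hφ : Measurable φ)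
    (hφf : ∀ x, ENNReal.ofReal (φ x) ≤ (‖f x‖₊ : ℝ≥0∞))
    (hint : ∫⁻ x, (‖f x‖₊ : ℝ≥0∞) ^ p = ∫⁻ x, ENNReal.ofReal (φ x) ^ p)
    (hfin : ∫⁻ x, ENNReal.ofReal (φ x) ^ p ≠ ⊤) (S : Set (Rd d)) :
    ∫⁻ y in S, (‖mulVecE M (mulVecE (matPow (V y) r) (f y))‖₊ : ℝ≥0∞) ≤
      ∫⁻ y in S, ENNReal.ofReal
        (∑ j, ‖mulVecE (matPow (V y) r) (mulVecE M (EuclideanSpace.single j 1))‖) *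
          ENNReal.ofReal (φ y) := by
  have hw : AEMeasurable (fun y =>
      ∑ j, ‖mulVecE (matPow (V y) r) (mulVecE M (EuclideanSpace.single j 1))‖) volume :=
    Finset.aemeasurable_fun_sum _ fun j _ =>
      aemeasurable_norm_mulVecE (aemeasurable_matPow hV r) _
  refine le_trans (lintegral_mono_ae ?_)
    (lintegral_mul_le_of_minorant hp hφ.ennreal_ofReal hφf hfin hint hw S)
  filter_upwards [ae_restrict_of_ae hV.2] with y hy
  have := norm_mulVecE_mulVecE_le hM (matPow_isHermitian hy.isHermitian r) (f y)
  rw [← enorm_eq_nnnorm, ← enorm_eq_nnnorm, ← ofReal_norm, ← ofReal_norm,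
    ← ENNReal.ofReal_mul (Finset.sum_nonneg fun _ _ => norm_nonneg _)]
  exact ENNReal.ofReal_le_ofReal this

/-- **Lemma 3.4.**  If `β/d = 1/p - 1/q` and `Φ̄ ∈ B_{p,q}`, the auxiliary maximal operator
`M^𝒟_{β,V}` is bounded from `L^p(ℝ^d,ℂ^n)` to `L^q(ℝ^d)`. -/
theorem auxiliary_maximal_bounded {d n : ℕ} (β p q : ℝ)
    (hβ0 : 0 ≤ β) (hβd : β < d) (hp : 1 < p) (hpq : p ≤ q)
    (hexp : β / (d : ℝ) = 1 / p - 1 / q)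
    (Φ : ℝ → ℝ) (hΦ : IsYoungFunction Φ) (hΦB : MemBpq (assoc Φ) p q)
    (V : Rd d → Mat n) (hV : IsMatrixWeight V)
    (𝒟 : Set (Cube d)) (h𝒟 : IsDyadicGrid 𝒟)
    (c₁ c₂ : ℝ) (hc₁ : 0 < c₁) (hc₂ : 0 < c₂)
    (𝒱 : Cube d → Mat n)
    (h𝒱 : ∀ Q ∈ 𝒟, ReducesOrlicz c₁ c₂ Φ (fun x => matPow (V x) (-(1 / p))) Q (𝒱 Q)) :
    ∃ C : ℝ, 0 < C ∧ ∀ f : Rd d → Cn n,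
      (∫⁻ x, auxDyadicMax β p 𝒟 𝒱 V f x ^ q) ^ (1 / q) ≤ ENNReal.ofReal C * lpNorm p f := by
  have hp0 : 0 < p := by linarith
  have hq0 : 0 < q := by linarith
  have hd : d ≠ 0 := by
    rintro rfl
    simp at hβd
    linarith
  have hb : 0 ≤ β / (d : ℝ) := by positivity
  have hΨ1 := hΦ.assoc_nonneg 1
  set K : ℝ := 2 / c₁ with hK
  have hK0 : 0 < K := by positivity
  set θ : ℝ := 1 / ((n + 1) * (K * (2 + assoc Φ 1))) with hθ
  have hθ0 : 0 < θ := by positivity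
  have hθK : n * (K * θ * (2 + assoc Φ 1)) ≤ 1 := by
    have : n * (K * θ * (2 + assoc Φ 1)) = n / (n + 1) := by
      rw [hθ]
      field_simp
    rw [this, div_le_one (by positivity)]
    linarith
  set B : ℝ≥0∞ := 2 ^ q * (ENNReal.ofReal (2 ^ (q + 1)) *
        ∫⁻ s in Set.Ioi (1 : ℝ), ENNReal.ofReal (assoc Φ s ^ (q / p) / s ^ (q + 1))) with hB
  have hBtop : B ≠ ⊤ := ENNReal.mul_ne_top (ENNReal.rpow_ne_top_of_nonneg hq0.le (by simp))
    (ENNReal.mul_ne_top ENNReal.ofReal_ne_top hΦB.ne)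
  set D : ℝ≥0∞ := (B * ENNReal.ofReal (θ⁻¹ ^ p) ^ (q / p)) ^ (1 / q) with hD
  have hDtop : D ≠ ⊤ := ENNReal.rpow_ne_top_of_nonneg (by positivity)
    (ENNReal.mul_ne_top hBtop
      (ENNReal.rpow_ne_top_of_nonneg (by positivity) ENNReal.ofReal_ne_top))
  refine ⟨D.toReal + 1, by positivity, fun f => ?_⟩
  obtain ⟨φ, hφ, hφ0, hφf, hint⟩ := exists_measurable_minorant volume hp0 fun x => ‖f x‖₊
  rcases eq_or_ne (∫⁻ x, ENNReal.ofReal (φ x) ^ p) ⊤ with htop | hfin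
  · rw [_root_.lpNorm, hint, htop, ENNReal.top_rpow_of_pos (by positivity), ENNReal.mul_top]
    · exact le_top
    · simpa using by positivity
  have hlux : ∀ Q ∈ 𝒟, ∀ j, ∫⁻ x in Q.set, ENNReal.ofReal (Φ (‖mulVecE (matPow (V x) (-(1 / p)))
      (mulVecE (𝒱 Q)⁻¹ (EuclideanSpace.single j 1))‖ / K)) ≤ ENNReal.ofReal Q.vol := by
    intro Q hQ j
    refine lintegral_le_vol_of_luxNorm_lt (w := fun x => ‖mulVecE (matPow (V x) (-(1 / p)))
      (mulVecE (𝒱 Q)⁻¹ (EuclideanSpace.single j 1))‖) hΦ (fun x => norm_nonneg _) ?_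
    have h1 := ((h𝒱 Q hQ).2 (mulVecE (𝒱 Q)⁻¹ (EuclideanSpace.single j 1))).1
    rw [← enorm_eq_nnnorm, ← ofReal_norm, norm_mulVecE_inv_single (h𝒱 Q hQ).1,
      ENNReal.ofReal_one, mul_comm] at h1
    refine lt_of_le_of_lt ((ENNReal.le_div_iff_mul_le (by simp [hc₁]) (by simp)).2 h1) ?_
    rw [← ENNReal.ofReal_one, ← ENNReal.ofReal_div_of_pos hc₁]
    exact (ENNReal.ofReal_lt_ofReal_iff hK0).2 (div_lt_div_of_pos_right (by norm_num) hc₁)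
  have hmain := lintegral_iSup_grid_rpow_le hd h𝒟 hΦ.monotone_assoc hΦ.assoc_nonneg hp0 hpq hb hexp
    (hφ.div_const θ) (fun x => div_nonneg (hφ0 x) hθ0.le)
    (g := fun Q => ENNReal.ofReal (Q.vol ^ (β / (d : ℝ) - 1)) *
      ∫⁻ y in Q.set, (‖mulVecE (𝒱 Q)⁻¹ (mulVecE (matPow (V y) (-(1 / p))) (f y))‖₊ : ℝ≥0∞)) (by
    intro Q hQ l hl hlt
    refine vol_le_lintegral_youngTail hΦ (b := β / d)
      (fun j => aemeasurable_norm_mulVecE (aemeasurable_matPow hV _) _)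
      (fun _ _ => norm_nonneg _) hK0 (hlux Q hQ) hφ hφ0 hθ0 hθK hl (hlt.trans_le ?_)
    exact mul_le_mul_right (lintegral_norm_le_of_minorant hV (h𝒱 Q hQ).1.isHermitian.inv hp0 _ hφ
      hφf hint hfin _) _)
  simp_rw [← auxDyadicMax_eq] at hmain
  have hJ : ∫⁻ y, ENNReal.ofReal ((φ y / θ) ^ p) =
      ENNReal.ofReal (θ⁻¹ ^ p) * ∫⁻ y, ENNReal.ofReal (φ y) ^ p := by
    rw [← lintegral_const_mul' _ _ ENNReal.ofReal_ne_top]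
    refine lintegral_congr fun y => ?_
    rw [ENNReal.ofReal_rpow_of_nonneg (hφ0 y) hp0.le, ← ENNReal.ofReal_mul (by positivity),
      div_eq_inv_mul, Real.mul_rpow (by positivity) (hφ0 y)]
  rw [← hB, hJ, ENNReal.mul_rpow_of_nonneg _ _ (by positivity), ← mul_assoc] at hmain
  refine (ENNReal.rpow_le_rpow hmain (by positivity)).trans ?_
  rw [ENNReal.mul_rpow_of_nonneg _ _ (by positivity), ← hD, ← ENNReal.rpow_mul,
    show q / p * (1 / q) = 1 / p by field_simp, _root_.lpNorm, hint]
  refine mul_le_mul' ?_ le_rfl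
  rw [← ENNReal.ofReal_toReal hDtop]
  exact ENNReal.ofReal_le_ofReal (by rw [ENNReal.toReal_ofReal ENNReal.toReal_nonneg]; linarith)

end
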